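/- Let $B$ be an $N \times n$ complex matrix ($n \le N$) satisfying $B^*\, E(n,N)\, B = \lambda I_n$ for some $\lambda > 0$. Then there exists an $N \times N$ matrix $U$ whose first $n$ rows are the rows of $B^*$ and such that $U\, E(n,N)\, U^* = \lambda\, E(n,N)$. -/

import Mathlib

open Matrix

/-- The signature matrix `E(n,N)`: diagonal with first `n` entries `1`, rest `-1`. -/
def sigMatrix (l N : ℕ) : Matrix (Fin N) (Fin N) ℂ :=
  Matrix.diagonal (fun j => if (j : ℕ) < l then 1 else -1)

section Aux

open scoped ComplexOrder MatrixOrder Matrix.Norms.L2Operator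

/-- An inverse square root. -/
lemma exists_whiten {m : ℕ} (S : Matrix (Fin m) (Fin m) ℂ) (hS : S.PosDef) :
    ∃ Z : Matrix (Fin m) (Fin m) ℂ, Z * S * Zᴴ = 1 := by
  obtain ⟨Y, hY⟩ := CStarAlgebra.nonneg_iff_eq_star_mul_self.mp hS.posSemidef.nonneg
  rw [star_eq_conjTranspose] at hY
  have hu : IsUnit Y.det := by
    have h1 : IsUnit S.det := (Matrix.isUnit_iff_isUnit_det S).1 hS.isUnit
    rw [hY, det_mul] at h1
    exact isUnit_of_mul_isUnit_right h1
  refine ⟨(Y⁻¹)ᴴ, ?_⟩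
  rw [hY, conjTranspose_conjTranspose]
  calc (Y⁻¹)ᴴ * (Yᴴ * Y) * Y⁻¹ = (Y * Y⁻¹)ᴴ * (Y * Y⁻¹) := by
        rw [conjTranspose_mul]; simp only [Matrix.mul_assoc]
    _ = 1 := by rw [Matrix.mul_nonsing_inv _ hu]; simp

lemma block_case {n m : ℕ} (P : Matrix (Fin n) (Fin n) ℂ) (Q : Matrix (Fin m) (Fin n) ℂ)
    (lam : ℝ) (hlam : 0 < lam)
    (h : Pᴴ * P - Qᴴ * Q = (lam : ℂ) • (1 : Matrix (Fin n) (Fin n) ℂ)) :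
    ∃ (C : Matrix (Fin m) (Fin n) ℂ) (D : Matrix (Fin m) (Fin m) ℂ),
      C * P - D * Q = 0 ∧ C * Cᴴ - D * Dᴴ = -((lam : ℂ) • (1 : Matrix (Fin m) (Fin m) ℂ)) := by
  have hPP : Pᴴ * P = (lam : ℂ) • (1 : Matrix (Fin n) (Fin n) ℂ) + Qᴴ * Q := by
    rw [← h]; abel
  have hl : (0 : ℂ) < (lam : ℂ) := by exact_mod_cast hlam
  set S : Matrix (Fin m) (Fin m) ℂ := (lam : ℂ) • 1 + Q * Qᴴ with hSdef
  have hS : S.PosDef :=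
    (Matrix.PosDef.one.smul hl).add_posSemidef (Matrix.posSemidef_self_mul_conjTranspose Q)
  have hSH : Sᴴ = S := hS.isHermitian
  obtain ⟨Z, hZ⟩ := exists_whiten S hS
  have hcomm : Q * (Pᴴ * P) = S * Q := by
    rw [hPP, hSdef, Matrix.mul_add, Matrix.add_mul]
    simp [Matrix.mul_assoc]
  have hQQ : Q * Qᴴ = S - (lam : ℂ) • 1 := by rw [hSdef]; abel
  refine ⟨Z * Q * Pᴴ, Z * S, ?_, ?_⟩
  · rw [Matrix.mul_assoc, Matrix.mul_assoc, hcomm, Matrix.mul_assoc, sub_self]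
  · have h1 : Z * Q * Pᴴ * (Z * Q * Pᴴ)ᴴ = Z * (Q * (Pᴴ * P)) * Qᴴ * Zᴴ := by
      simp only [conjTranspose_mul, conjTranspose_conjTranspose, Matrix.mul_assoc]
    have h2 : Z * (S * Q) * Qᴴ * Zᴴ = Z * S * (Q * Qᴴ) * Zᴴ := by
      simp only [Matrix.mul_assoc]
    rw [h1, hcomm, h2, hQQ, conjTranspose_mul, hSH, Matrix.mul_sub, Matrix.sub_mul,
      Matrix.mul_smul, Matrix.mul_one, Matrix.smul_mul, hZ]
    simp only [Matrix.mul_assoc]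
    abel

end Aux

lemma sig_block (n m : ℕ) : sigMatrix n (n + m) =
    (fromBlocks (1 : Matrix (Fin n) (Fin n) ℂ) 0 0 (-1 : Matrix (Fin m) (Fin m) ℂ)).submatrix
      finSumFinEquiv.symm finSumFinEquiv.symm := by
  ext i j
  obtain ⟨i, rfl⟩ := finSumFinEquiv.surjective i
  obtain ⟨j, rfl⟩ := finSumFinEquiv.surjective j
  rw [submatrix_apply, Equiv.symm_apply_apply, Equiv.symm_apply_apply, sigMatrix,
    Matrix.diagonal_apply]
  simp only [EmbeddingLike.apply_eq_iff_eq]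
  rcases i with i | i <;> rcases j with j | j <;> simp [Matrix.one_apply]
  split_ifs <;> simp

/-- If `B* E(n,N) B = λ Iₙ` with `λ > 0`, then there is an `N × N` matrix `U` whose
first `n` rows are the rows of `B*` and with `U E(n,N) U* = λ E(n,N)`. -/
theorem stmt3 (n N : ℕ) (hnN : n ≤ N) (B : Matrix (Fin N) (Fin n) ℂ) (lam : ℝ)
    (hlam : 0 < lam)
    (h : Bᴴ * sigMatrix n N * B = (lam : ℂ) • (1 : Matrix (Fin n) (Fin n) ℂ)) :
    ∃ U : Matrix (Fin N) (Fin N) ℂ,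
      (∀ (i : Fin n) (j : Fin N), U (Fin.castLE hnN i) j = Bᴴ i j) ∧
      U * sigMatrix n N * Uᴴ = (lam : ℂ) • sigMatrix n N := by
  obtain ⟨m, rfl⟩ := Nat.exists_eq_add_of_le hnN
  set P : Matrix (Fin n) (Fin n) ℂ := fun i j => B (finSumFinEquiv (Sum.inl i)) j with hP
  set Q : Matrix (Fin m) (Fin n) ℂ := fun i j => B (finSumFinEquiv (Sum.inr i)) j with hQ
  have hB : B = (fromRows P Q).submatrix finSumFinEquiv.symm id := by
    ext i j
    obtain ⟨i, rfl⟩ := finSumFinEquiv.surjective i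
    rw [submatrix_apply, Equiv.symm_apply_apply]
    rcases i with i | i <;> rfl
  have hPQ : Pᴴ * P - Qᴴ * Q = (lam : ℂ) • (1 : Matrix (Fin n) (Fin n) ℂ) := by
    rw [← h, hB, sig_block, conjTranspose_submatrix, submatrix_mul_equiv, submatrix_mul_equiv,
      conjTranspose_fromRows_eq_fromCols_conjTranspose, fromCols_mul_fromBlocks,
      fromCols_mul_fromRows]
    simp [sub_eq_add_neg]
  obtain ⟨C, D, h1, h2⟩ := block_case P Q lam hlam hPQ
  have h1' : Pᴴ * Cᴴ - Qᴴ * Dᴴ = 0 := by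
    have := congrArg conjTranspose h1
    simpa [conjTranspose_sub, conjTranspose_mul] using this
  refine ⟨(fromBlocks Pᴴ Qᴴ C D).submatrix finSumFinEquiv.symm finSumFinEquiv.symm, ?_, ?_⟩
  · intro i j
    obtain ⟨j, rfl⟩ := finSumFinEquiv.surjective j
    have hi : Fin.castLE hnN i = finSumFinEquiv (Sum.inl i : Fin n ⊕ Fin m) := by
      ext; simp
    rw [hi, submatrix_apply, Equiv.symm_apply_apply, Equiv.symm_apply_apply]
    rcases j with j | j <;> rfl
  · rw [sig_block, conjTranspose_submatrix, submatrix_mul_equiv, submatrix_mul_equiv,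
      fromBlocks_conjTranspose, fromBlocks_multiply, fromBlocks_multiply]
    have e : (lam : ℂ) • (fromBlocks (1 : Matrix (Fin n) (Fin n) ℂ) 0 0
        (-1 : Matrix (Fin m) (Fin m) ℂ)) =
        fromBlocks (Pᴴ * P - Qᴴ * Q) (Pᴴ * Cᴴ - Qᴴ * Dᴴ) (C * P - D * Q)
          (C * Cᴴ - D * Dᴴ) := by
      rw [hPQ, h1', h1, h2, fromBlocks_smul]; simp
    rw [show ∀ A : Matrix (Fin n ⊕ Fin m) (Fin n ⊕ Fin m) ℂ, (lam : ℂ) • A.submatrix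
      finSumFinEquiv.symm finSumFinEquiv.symm = ((lam : ℂ) • A).submatrix
      finSumFinEquiv.symm finSumFinEquiv.symm from fun _ => rfl, e]
    simp [sub_eq_add_neg]
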